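/- arXiv:2504.05688 — 2 statements merged into one kernel-verified Lean document; each statement's English description precedes it below -/
import Mathlib

section
/- Let G be the cyclic group of order n ≥ 2 and SL(ℂG) the group of n×n circulant matrices with determinant 1. Then the invariant ring ℂ[x_0,...,x_{n-1}]^{SL(ℂG)} := {f : f(Ax) = f(x) for all A ∈ SL(ℂG)} equals ℂ[Θ_n(x)], the polynomial ring generated by the circulant determinant. -/
open MvPolynomial

open scoped ZMod

noncomputable section Aux

/-- Fourier matrix. -/
def fourM (n : ℕ) [NeZero n] : Matrix (ZMod n) (ZMod n) ℂ :=
  Matrix.of fun j k => ZMod.stdAddChar (j * k)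

lemma fourM_isUnit (n : ℕ) [NeZero n] : IsUnit (fourM n).det := by
  have h : fourM n * (Matrix.of fun j k => ZMod.stdAddChar (-(j * k))) =
      (n : ℂ) • (1 : Matrix (ZMod n) (ZMod n) ℂ) := by
    ext i k
    simp only [fourM, Matrix.mul_apply, Matrix.of_apply, Matrix.smul_apply, Matrix.one_apply]
    have := AddChar.sum_mulShift (i - k) (ZMod.isPrimitive_stdAddChar n)
    rw [ZMod.card] at this
    simp only [sub_eq_zero] at this
    have h2 : ∀ x : ZMod n, (ZMod.stdAddChar (i * x) * ZMod.stdAddChar (-(x * k)) : ℂ) =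
        ZMod.stdAddChar (x * (i - k)) := by
      intro x
      rw [← AddChar.map_add_eq_mul]
      congr 1
      ring
    simp only [h2, this]
    simp
  have h3 := congrArg Matrix.det h
  rw [Matrix.det_mul, Matrix.det_smul, Matrix.det_one, mul_one] at h3
  refine isUnit_iff_ne_zero.mpr fun h0 => ?_
  rw [h0, zero_mul] at h3
  exact pow_ne_zero _ (Nat.cast_ne_zero.mpr (NeZero.ne n)) h3.symm

lemma det_circulant_eq (n : ℕ) [NeZero n] {R : Type*} [CommRing R] [Algebra ℂ R]
    (v : ZMod n → R) : (Matrix.circulant v).det = ∏ k, ZMod.dft v k := by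
  have h : Matrix.circulant v * (fourM n).map (algebraMap ℂ R) =
      (fourM n).map (algebraMap ℂ R) * Matrix.diagonal (ZMod.dft v) := by
    ext i k
    rw [Matrix.mul_diagonal, Matrix.mul_apply, ZMod.dft_apply, Finset.mul_sum]
    refine Fintype.sum_equiv (Equiv.subLeft i) _ _ fun j => ?_
    simp only [fourM, Matrix.circulant_apply, Matrix.map_apply, Matrix.of_apply,
      Equiv.subLeft_apply, Algebra.smul_def]
    rw [← mul_assoc, ← map_mul, ← AddChar.map_add_eq_mul, mul_comm]
    congr 3
    ring
  have h3 := congrArg Matrix.det h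
  rw [Matrix.det_mul, Matrix.det_mul, Matrix.det_diagonal, mul_comm] at h3
  have hu : IsUnit ((fourM n).map (algebraMap ℂ R)).det := by
    have := (fourM_isUnit n).map (algebraMap ℂ R)
    rwa [RingHom.map_det] at this
  exact hu.mul_left_cancel h3

/-- The Fourier transformed variables. -/
def fY (n : ℕ) [NeZero n] : ZMod n → MvPolynomial (ZMod n) ℂ := ZMod.dft X

/-- Action of a circulant matrix. -/
def act (n : ℕ) [NeZero n] (a : ZMod n → ℂ) :
    MvPolynomial (ZMod n) ℂ →ₐ[ℂ] MvPolynomial (ZMod n) ℂ :=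
  aeval (fun i : ZMod n => ∑ j : ZMod n, C (Matrix.circulant a i j) * X j)

lemma act_fY (n : ℕ) [NeZero n] (a : ZMod n → ℂ) (k : ZMod n) :
    act n a (fY n k) = C (ZMod.dft a k) * fY n k := by
  simp only [fY, ZMod.dft_apply, map_sum, map_smul, act, aeval_X, Finset.smul_sum,
    Finset.sum_mul]
  rw [Finset.sum_comm]
  simp only [Finset.mul_sum]
  rw [Finset.sum_comm (s := Finset.univ) (t := Finset.univ)
    (f := fun i j => C (ZMod.stdAddChar (-(i * k)) • a i) *
      (ZMod.stdAddChar (-(j * k)) • (X j : MvPolynomial (ZMod n) ℂ)))]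
  refine Finset.sum_congr rfl fun j _ => ?_
  refine Fintype.sum_equiv (Equiv.subRight j) _ _ fun i => ?_
  simp only [Matrix.circulant_apply, Equiv.subRight_apply, smul_eq_C_mul, smul_eq_mul, map_mul]
  have : (ZMod.stdAddChar (-(i * k)) : ℂ) =
      ZMod.stdAddChar (-((i - j) * k)) * ZMod.stdAddChar (-(j * k)) := by
    rw [← AddChar.map_add_eq_mul]
    congr 1
    ring
  rw [this, map_mul]
  ring

lemma theta_eq (n : ℕ) [NeZero n] :
    (Matrix.circulant (X : ZMod n → MvPolynomial (ZMod n) ℂ)).det = ∏ k, fY n k :=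
  det_circulant_eq n _

lemma fY_surj (n : ℕ) [NeZero n] (f : MvPolynomial (ZMod n) ℂ) :
    aeval (fY n) (aeval (ZMod.dft.symm X : ZMod n → MvPolynomial (ZMod n) ℂ) f) = f := by
  have : (aeval (fY n)).comp (aeval (ZMod.dft.symm X : ZMod n → MvPolynomial (ZMod n) ℂ)) =
      AlgHom.id ℂ (MvPolynomial (ZMod n) ℂ) := by
    ext1 k
    have h2 : (ZMod.dft.symm (fY n)) k = X k := by
      rw [fY, LinearEquiv.symm_apply_apply]
    simp only [AlgHom.comp_apply, aeval_X, AlgHom.id_apply]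
    rw [← h2, ZMod.invDFT_apply, ZMod.invDFT_apply]
    simp [map_sum, map_smul]
  exact DFunLike.congr_fun this f

lemma fY_inj (n : ℕ) [NeZero n] (f : MvPolynomial (ZMod n) ℂ) :
    (aeval (ZMod.dft.symm X : ZMod n → MvPolynomial (ZMod n) ℂ) (aeval (fY n) f)) = f := by
  have : (aeval (ZMod.dft.symm X : ZMod n → MvPolynomial (ZMod n) ℂ)).comp (aeval (fY n)) =
      AlgHom.id ℂ (MvPolynomial (ZMod n) ℂ) := by
    ext1 k
    have h2 : (ZMod.dft (ZMod.dft.symm (X : ZMod n → MvPolynomial (ZMod n) ℂ))) k = X k := by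
      rw [LinearEquiv.apply_symm_apply]
    simp only [AlgHom.comp_apply, aeval_X, AlgHom.id_apply]
    rw [← h2, fY, ZMod.dft_apply, ZMod.dft_apply]
    simp [map_sum, map_smul]
  exact DFunLike.congr_fun this f

lemma coeff_scale {σ : Type*} [Fintype σ] (l : σ → ℂ) (g : MvPolynomial σ ℂ) (m : σ →₀ ℕ) :
    coeff m (aeval (fun k => C (l k) * X k : σ → MvPolynomial σ ℂ) g) =
      (∏ k, l k ^ m k) * coeff m g := by
  classical
  induction g using MvPolynomial.induction_on' with
  | add p q hp hq => rw [map_add, coeff_add, coeff_add, hp, hq, mul_add]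
  | monomial u c =>
    have : aeval (fun k => C (l k) * X k : σ → MvPolynomial σ ℂ) (monomial u c) =
        monomial u ((∏ k, l k ^ u k) * c) := by
      rw [aeval_monomial, Finsupp.prod_fintype _ _ (by simp)]
      simp only [mul_pow, Finset.prod_mul_distrib]
      rw [monomial_eq (s := u), Finsupp.prod_fintype _ _ (by simp)]
      simp only [map_mul, map_prod, map_pow, algebraMap_eq]
      ring
    rw [this, coeff_monomial, coeff_monomial]
    split_ifs with h
    · rw [h]
    · simp

end Aux

/-- The invariant ring of `SL(ℂG)` (circulant matrices of determinant 1, `G` cyclic of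
order `n`) acting by substitution `x ↦ Ax` on `ℂ[x_0,…,x_{n-1}]` is the polynomial ring
generated by the circulant determinant `Θ_n(x)`. -/
theorem stmt17 (n : ℕ) (hn : 2 ≤ n) [NeZero n] :
    {f : MvPolynomial (ZMod n) ℂ |
      ∀ a : ZMod n → ℂ, (Matrix.circulant a).det = 1 →
        aeval (fun i : ZMod n => ∑ j : ZMod n, C (Matrix.circulant a i j) * X j) f = f}
    = ↑(Algebra.adjoin ℂ
        {(Matrix.circulant (X : ZMod n → MvPolynomial (ZMod n) ℂ)).det}) := by
  rw [theta_eq]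
  apply Set.Subset.antisymm
  · intro f hf
    obtain ⟨g, rfl⟩ : ∃ g, aeval (fY n) g = f := ⟨_, fY_surj n f⟩
    have key : ∀ l : ZMod n → ℂ, ∏ k, l k = 1 →
        aeval (fun k => C (l k) * X k : ZMod n → MvPolynomial (ZMod n) ℂ) g = g := by
      intro l hl
      have hd : (Matrix.circulant (ZMod.dft.symm l)).det = 1 := by
        rw [det_circulant_eq, LinearEquiv.apply_symm_apply, hl]
      have h1 : act n (ZMod.dft.symm l) (aeval (fY n) g) = aeval (fY n) g := hf _ hd
      have h2 : (act n (ZMod.dft.symm l)).comp (aeval (fY n)) =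
          (aeval (fY n)).comp
            (aeval (fun k => C (l k) * X k : ZMod n → MvPolynomial (ZMod n) ℂ)) := by
        ext1 k
        simp only [AlgHom.comp_apply, aeval_X, act_fY, LinearEquiv.apply_symm_apply, map_mul,
          aeval_C, algebraMap_eq]
      have h3 := DFunLike.congr_fun h2 g
      simp only [AlgHom.comp_apply] at h3
      rw [h1] at h3
      have := congrArg
        (aeval (ZMod.dft.symm X : ZMod n → MvPolynomial (ZMod n) ℂ)) h3
      rw [fY_inj, fY_inj] at this
      exact this.symm
    have hconst : ∀ m ∈ g.support, ∀ k, m k = m 0 := by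
      intro m hm k
      by_contra hne
      have hk : k ≠ 0 := fun h => hne (by rw [h])
      let l : ZMod n → ℂ := fun i => if i = k then 2 else if i = 0 then 2⁻¹ else 1
      have hprod : ∀ e : ZMod n → ℕ, ∏ i, l i ^ e i = 2 ^ e k * (2⁻¹) ^ e 0 := by
        intro e
        rw [Fintype.prod_eq_mul k 0 hk]
        · simp [l, hk.symm]
        · rintro x ⟨h1, h2⟩
          simp [l, h1, h2]
      have hl : ∏ i, l i = 1 := by
        have := hprod (fun _ => 1)
        simpa using this
      have h1 := congrArg (coeff m) (key l hl)
      rw [coeff_scale, hprod] at h1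
      have h2 : (2 : ℂ) ^ m k * (2⁻¹) ^ m 0 = 1 :=
        mul_right_cancel₀ (mem_support_iff.mp hm) (by rw [h1, one_mul])
      have h3 : (2 : ℂ) ^ m k = 2 ^ m 0 := by
        rw [inv_pow] at h2
        exact (mul_inv_eq_one₀ (pow_ne_zero _ two_ne_zero)).mp h2
      have h4 : (2 : ℕ) ^ m k = 2 ^ m 0 := by exact_mod_cast h3
      exact hne (Nat.pow_right_injective le_rfl h4)
    rw [SetLike.mem_coe, g.as_sum, map_sum]
    refine Subalgebra.sum_mem _ fun m hm => ?_
    rw [aeval_monomial, Finsupp.prod_fintype _ _ (by simp)]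
    simp only [hconst m hm]
    rw [Finset.prod_pow]
    have hT := Algebra.subset_adjoin (R := ℂ) (Set.mem_singleton (∏ k, fY n k))
    exact mul_mem (Subalgebra.algebraMap_mem _ _) (pow_mem hT _)
  · intro f hf a ha
    have hle : Algebra.adjoin ℂ {∏ k, fY n k} ≤
        AlgHom.equalizer (act n a) (AlgHom.id ℂ _) := by
      rw [Algebra.adjoin_le_iff, Set.singleton_subset_iff, SetLike.mem_coe,
        AlgHom.mem_equalizer, map_prod]
      simp only [act_fY, Finset.prod_mul_distrib]
      rw [← map_prod, ← det_circulant_eq, ha]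
      simp
    exact hle hf
end

section
/- If n has at least three distinct prime factors, then the invariant ring ℂ[x]^D = {f ∈ ℂ[x_0,...,x_{n-1}] : Df = 0}, where D = Σ_i x_{i-1} ∂/∂x_i (indices mod n), strictly contains the subring R_n generated by the circulant determinants Θ_p(y^(p)_i) for p ranging over prime factors of n and 0 ≤ i ≤ n/p − 1. -/
open MvPolynomial

/-- The variable `y^(p)_{i,j} = ∑_{l<n/p} ζ^{i(j+pl)} x_{j+pl}`. -/
noncomputable def ypVar (n p : ℕ) [NeZero n] (ζ : ℂ) (i j : ℕ) :
    MvPolynomial (ZMod n) ℂ :=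
  ∑ l ∈ Finset.range (n / p), C (ζ ^ (i * (j + p * l))) * X ((j + p * l : ℕ) : ZMod n)

/-- The circulant determinant of order `p` with first column `a_0, …, a_{p-1}`. -/
def thetaCirc {R : Type*} [CommRing R] (p : ℕ) (a : ℕ → R) : R :=
  (Matrix.circulant fun j : Fin p => a (j : ℕ)).det

namespace S19

variable {n : ℕ} [NeZero n]

noncomputable def psi (ζ : ℂ) (h : ζ ^ n = 1) : AddChar (ZMod n) ℂ := AddChar.zmodChar n h

/-- eigenvectors -/
noncomputable def u (ψ : AddChar (ZMod n) ℂ) (m : ZMod n) : MvPolynomial (ZMod n) ℂ :=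
  ∑ k : ZMod n, C (ψ (m * k)) * X k

noncomputable def D (n : ℕ) [NeZero n] :
    Derivation ℂ (MvPolynomial (ZMod n) ℂ) (MvPolynomial (ZMod n) ℂ) :=
  ∑ k : ZMod n, (X (k - 1) : MvPolynomial (ZMod n) ℂ) • pderiv k

lemma D_apply (f : MvPolynomial (ZMod n) ℂ) :
    D n f = ∑ k : ZMod n, X (k - 1) * pderiv k f := by
  unfold D
  rw [← Derivation.coeFnAddMonoidHom_apply, map_sum, Finset.sum_apply]
  simp [Derivation.coeFnAddMonoidHom]

lemma D_X (k : ZMod n) : D n (X k) = X (k - 1) := by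
  rw [D_apply, Finset.sum_eq_single k]
  · simp
  · intro b _ hb
    rw [pderiv_X_of_ne (Ne.symm hb), mul_zero]
  · simp

lemma D_u (ψ : AddChar (ZMod n) ℂ) (m : ZMod n) : D n (u ψ m) = C (ψ m) * u ψ m := by
  unfold u
  rw [map_sum, Finset.mul_sum]
  rw [← Equiv.sum_comp (Equiv.subRight (1 : ZMod n)) (fun i => C (ψ m) * (C (ψ (m * i)) * X i))]
  refine Finset.sum_congr rfl fun k _ => ?_
  rw [← smul_eq_C_mul, Derivation.map_smul, D_X, smul_eq_C_mul, ← mul_assoc, ← C_mul,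
    ← AddChar.map_add_eq_mul]
  simp only [Equiv.subRight_apply]
  congr 3
  ring

lemma D_prod {ι : Type*} (s : Finset ι) (ψ : AddChar (ZMod n) ℂ) (g : ι → ZMod n) :
    D n (∏ i ∈ s, u ψ (g i)) = C (∑ i ∈ s, ψ (g i)) * ∏ i ∈ s, u ψ (g i) := by
  classical
  induction s using Finset.induction_on with
  | empty => simp
  | insert a s ha ih =>
    rw [Finset.prod_insert ha, Finset.sum_insert ha, Derivation.leibniz, ih, D_u, C_add]
    simp only [smul_eq_mul]
    ring

/-- the dual point -/
noncomputable def pt (ψ : AddChar (ZMod n) ℂ) (S : Set (ZMod n)) : ZMod n → ℂ := by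
  classical
  exact fun k => (n : ℂ)⁻¹ * ∑ s : ZMod n, if s ∈ S then ψ (-(s * k)) else 0

lemma aeval_u (ψ : AddChar (ZMod n) ℂ) (hψ : ψ.IsPrimitive) (S : Set (ZMod n)) (m : ZMod n)
    [Decidable (m ∈ S)] :
    aeval (pt ψ S) (u ψ m) = if m ∈ S then 1 else 0 := by
  classical
  have hn : (n : ℂ) ≠ 0 := Nat.cast_ne_zero.mpr (NeZero.ne n)
  unfold u pt
  simp only [map_sum, map_mul, aeval_X, aeval_C, Algebra.algebraMap_self, RingHom.id_apply]
  have : ∀ x : ZMod n, ψ (m * x) * ((n : ℂ)⁻¹ * ∑ s : ZMod n, if s ∈ S then ψ (-(s * x)) else 0)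
      = (n : ℂ)⁻¹ * ∑ s : ZMod n, if s ∈ S then ψ (x * (m - s)) else 0 := by
    intro x
    rw [mul_left_comm, Finset.mul_sum]
    congr 1
    refine Finset.sum_congr rfl fun s _ => ?_
    split_ifs
    · rw [← AddChar.map_add_eq_mul]; congr 1; ring
    · simp
  simp only [this]
  rw [← Finset.mul_sum, Finset.sum_comm]
  have h2 : ∀ s : ZMod n, (∑ x : ZMod n, if s ∈ S then ψ (x * (m - s)) else 0)
      = if m = s then (if m ∈ S then (n : ℂ) else 0) else 0 := by
    intro s
    have := AddChar.sum_mulShift (m - s) hψ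
    simp only [ZMod.card, sub_eq_zero] at this
    by_cases hs : s ∈ S
    · simp only [hs, if_true, this]
      split_ifs with h1 h2
      · simp
      · exact absurd (h1 ▸ hs) h2
      · simp
    · simp only [hs, if_false]
      split_ifs with h1 h2
      · exact absurd (h1 ▸ h2) hs
      · simp
      · simp
  simp only [h2]
  rw [Finset.sum_ite_eq]
  split_ifs <;> simp_all

lemma aeval_zero_u (ψ : AddChar (ZMod n) ℂ) (m : ZMod n) :
    aeval (0 : ZMod n → ℂ) (u ψ m) = 0 := by
  simp [u]

lemma det_circ {p : ℕ} [NeZero p] (ω : ℂ) (hω : IsPrimitiveRoot ω p)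
    (a : ℕ → MvPolynomial (ZMod n) ℂ) :
    thetaCirc p a = ∏ k : Fin p, ∑ j : Fin p, C (ω ^ ((k : ℕ) * j)) * a j := by
  have hC : Function.Injective (C : ℂ → MvPolynomial (ZMod n) ℂ) := C_injective _ _
  set F : Matrix (Fin p) (Fin p) (MvPolynomial (ZMod n) ℂ) :=
    Matrix.vandermonde fun k : Fin p => C (ω ^ (k : ℕ)) with hF
  have hdet : F.det ≠ 0 := by
    rw [hF, Matrix.det_vandermonde_ne_zero_iff]
    intro x y hxy
    exact Fin.ext (hω.pow_inj x.2 y.2 (hC hxy))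
  have key : F * Matrix.circulant (fun j : Fin p => a (j : ℕ))
      = Matrix.diagonal (fun k : Fin p => ∑ j : Fin p, C (ω ^ ((k : ℕ) * j)) * a j) * F := by
    ext1 k j
    rw [Matrix.diagonal_mul, Matrix.mul_apply, Finset.sum_mul]
    rw [← Equiv.sum_comp (Equiv.subRight j)
      (fun i : Fin p => C (ω ^ ((k : ℕ) * i)) * a i * F k j)]
    refine Finset.sum_congr rfl fun i _ => ?_
    simp only [Equiv.subRight_apply, hF, Matrix.vandermonde_apply, Matrix.circulant_apply]
    rw [mul_right_comm, ← C_pow, ← C_pow, ← C_mul]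
    congr 2
    rw [← pow_mul, ← pow_mul, ← pow_add, ← mul_add, pow_mul', pow_mul']
    congr 1
    have h := congrArg Fin.val (sub_add_cancel i j)
    rw [Fin.val_add] at h
    rw [← h]
    exact (pow_eq_pow_mod _ hω.pow_eq_one).symm
  have := congrArg Matrix.det key
  rw [Matrix.det_mul, Matrix.det_mul, Matrix.det_diagonal, mul_comm] at this
  exact mul_right_cancel₀ hdet this

lemma sum_zmod {M : Type*} [AddCommMonoid M] {p : ℕ} (hp : p ∣ n) (g : ZMod n → M) :
    ∑ x : ZMod n, g x = ∑ j : Fin p, ∑ l ∈ Finset.range (n / p), g ((j + p * l : ℕ) : ZMod n) := by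
  have hn : 0 < n := NeZero.pos n
  have hp0 : 0 < p := Nat.pos_of_dvd_of_pos hp hn
  obtain ⟨q, hq⟩ := hp
  have hdiv : n / p = q := by rw [hq, Nat.mul_div_cancel_left _ hp0]
  rw [hdiv, ← Finset.sum_product']
  symm
  refine Finset.sum_bij' (fun x _ => ((x.1 + p * x.2 : ℕ) : ZMod n))
    (fun x _ => (⟨x.val % p, Nat.mod_lt _ hp0⟩, x.val / p)) ?_ ?_ ?_ ?_ ?_
  · simp
  · intro x _
    simp only [Finset.mem_product, Finset.mem_univ, true_and, Finset.mem_range]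
    rw [Nat.div_lt_iff_lt_mul hp0, mul_comm, ← hq]
    exact ZMod.val_lt x
  · rintro ⟨j, l⟩ hx
    simp only [Finset.mem_product, Finset.mem_univ, true_and, Finset.mem_range] at hx
    have hlt : (j : ℕ) + p * l < n := by
      have h1 := j.2
      have h2 : p * (l + 1) ≤ p * q := Nat.mul_le_mul_left _ hx
      rw [hq]; nlinarith
    simp only [ZMod.val_natCast, Nat.mod_eq_of_lt hlt]
    refine Prod.ext (Fin.ext ?_) ?_
    · simp [Nat.add_mul_mod_self_left, Nat.mod_eq_of_lt j.2]
    · simp [Nat.add_mul_div_left _ _ hp0, Nat.div_eq_of_lt j.2]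
  · intro x _
    simp only [Nat.mod_add_div, ZMod.natCast_zmod_val]
  · simp

lemma psi_nat (ζ : ℂ) (h : ζ ^ n = 1) (t : ℕ) : psi ζ h (t : ZMod n) = ζ ^ t :=
  AddChar.zmodChar_apply' h t

lemma theta_eq {p : ℕ} (hp0 : p ≠ 0) (hp : p ∣ n) (ζ : ℂ) (hζ : IsPrimitiveRoot ζ n) (i : ℕ) :
    thetaCirc p (fun j => ypVar n p ζ i j)
      = ∏ k : Fin p, u (psi ζ hζ.pow_eq_one) ((i + n / p * k : ℕ) : ZMod n) := by
  have : NeZero p := ⟨hp0⟩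
  have hnp : n / p * p = n := Nat.div_mul_cancel hp
  rw [det_circ (ζ ^ (n / p)) (hζ.pow (NeZero.pos n) hnp.symm)]
  refine Finset.prod_congr rfl fun k _ => ?_
  unfold u
  rw [sum_zmod hp]
  refine Finset.sum_congr rfl fun j _ => ?_
  rw [ypVar, Finset.mul_sum]
  refine Finset.sum_congr rfl fun l _ => ?_
  rw [← mul_assoc, ← C_mul, ← Nat.cast_mul, psi_nat]
  congr 2
  rw [← pow_mul, ← pow_add]
  have : (i + n / p * k) * (j + p * l) = n / p * (k * j) + i * (j + p * l) + n * (k * l) := by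
    conv_rhs => rw [← hnp]
    rw [Nat.mul_div_cancel _ (Nat.pos_of_ne_zero hp0)]
    ring
  rw [this, pow_add _ _ (n * _), pow_mul _ n, hζ.pow_eq_one, one_pow, mul_one]

lemma sum_root {p : ℕ} (hp : p.Prime) (hpn : p ∣ n) (ζ : ℂ) (hζ : IsPrimitiveRoot ζ n) :
    ∑ k ∈ Finset.range p, psi ζ hζ.pow_eq_one ((n / p * k : ℕ) : ZMod n) = 0 := by
  have hnp : n / p * p = n := Nat.div_mul_cancel hpn
  simp only [psi_nat, pow_mul]
  exact (hζ.pow (NeZero.pos n) hnp.symm).geom_sum_eq_zero hp.one_lt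

lemma sum_root' {p : ℕ} (hp : p.Prime) (hpn : p ∣ n) (ζ : ℂ) (hζ : IsPrimitiveRoot ζ n) :
    ∑ k ∈ Finset.Ico 1 p, psi ζ hζ.pow_eq_one ((n / p * k : ℕ) : ZMod n) = -1 := by
  have := sum_root hp hpn ζ hζ
  rw [Finset.range_eq_Ico, Finset.sum_eq_sum_Ico_succ_bot hp.pos] at this
  simp at this
  simp
  linear_combination this

lemma mul_zero_iff {l : ℕ} (hl : l ∣ n) (t : ℕ) :
    ((t : ZMod n) * ((n / l : ℕ) : ZMod n) = 0) ↔ l ∣ t := by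
  have hnp : n / l * l = n := Nat.div_mul_cancel hl
  have h0 : 0 < n / l := Nat.div_pos (Nat.le_of_dvd (NeZero.pos n) hl)
    (Nat.pos_of_dvd_of_pos hl (NeZero.pos n))
  rw [← Nat.cast_mul, ZMod.natCast_eq_zero_iff]
  conv_lhs => rw [← hnp]
  rw [Nat.mul_div_cancel _ (Nat.pos_of_dvd_of_pos hl (NeZero.pos n)), mul_comm t]
  exact Nat.mul_dvd_mul_iff_left h0

/-- the support -/
def S (n p q r : ℕ) : Set (ZMod n) :=
  {x | (∃ a ∈ Finset.Ico 1 p, ∃ b ∈ Finset.Ico 1 q,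
      x = ((n / p * a : ℕ) : ZMod n) + ((n / q * b : ℕ) : ZMod n)) ∨
    ∃ c ∈ Finset.Ico 1 r, x = ((n / r * c : ℕ) : ZMod n)}


lemma ndvd_of_Ico {p a : ℕ} (h : a ∈ Finset.Ico 1 p) : ¬ p ∣ a := by
  rw [Finset.mem_Ico] at h
  exact Nat.not_dvd_of_pos_of_lt h.1 h.2

lemma S_sub {p q r : ℕ} (hp : p.Prime) (hq : q.Prime) (hr : r.Prime)
    (hpn : p ∣ n) (hqn : q ∣ n) (hrn : r ∣ n) (hpq : p ≠ q) (hpr : p ≠ r) (hqr : q ≠ r)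
    {x : ZMod n} (hx : x ∈ S n p q r) :
    ((p * q * x : ZMod n) = 0 ∧ (q * r * x : ZMod n) ≠ 0 ∧ (p * r * x : ZMod n) ≠ 0) ∨
    ((r * x : ZMod n) = 0 ∧ (p * q * x : ZMod n) ≠ 0) := by
  have hP : (p : ZMod n) * ((n / p : ℕ) : ZMod n) = 0 := (mul_zero_iff hpn p).2 dvd_rfl
  have hQ : (q : ZMod n) * ((n / q : ℕ) : ZMod n) = 0 := (mul_zero_iff hqn q).2 dvd_rfl
  have hR : (r : ZMod n) * ((n / r : ℕ) : ZMod n) = 0 := (mul_zero_iff hrn r).2 dvd_rfl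
  have e1 := fun h => hpq ((Nat.prime_dvd_prime_iff_eq hp hq).1 h)
  have e2 := fun h => hpr ((Nat.prime_dvd_prime_iff_eq hp hr).1 h)
  have e3 := fun h => hqr ((Nat.prime_dvd_prime_iff_eq hq hr).1 h)
  have e4 := fun h => hpq.symm ((Nat.prime_dvd_prime_iff_eq hq hp).1 h)
  have e5 := fun h => hpr.symm ((Nat.prime_dvd_prime_iff_eq hr hp).1 h)
  have e6 := fun h => hqr.symm ((Nat.prime_dvd_prime_iff_eq hr hq).1 h)
  rcases hx with ⟨a, ha, b, hb, rfl⟩ | ⟨c, hc, rfl⟩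
  · left
    simp only [Nat.cast_mul]
    refine ⟨by linear_combination (q * a : ZMod n) * hP + (p * b : ZMod n) * hQ, ?_, ?_⟩
    · intro h
      have : ((q * r * a : ℕ) : ZMod n) * ((n / p : ℕ) : ZMod n) = 0 := by
        simp only [Nat.cast_mul]
        linear_combination h - (r * b : ZMod n) * hQ
      rw [mul_zero_iff hpn, hp.dvd_mul, hp.dvd_mul] at this
      have := ndvd_of_Ico ha
      tauto
    · intro h
      have : ((p * r * b : ℕ) : ZMod n) * ((n / q : ℕ) : ZMod n) = 0 := by
        simp only [Nat.cast_mul]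
        linear_combination h - (r * a : ZMod n) * hP
      rw [mul_zero_iff hqn, hq.dvd_mul, hq.dvd_mul] at this
      have := ndvd_of_Ico hb
      tauto
  · right
    simp only [Nat.cast_mul]
    refine ⟨by linear_combination (c : ZMod n) * hR, ?_⟩
    intro h
    have : ((p * q * c : ℕ) : ZMod n) * ((n / r : ℕ) : ZMod n) = 0 := by
      simp only [Nat.cast_mul]
      linear_combination h
    rw [mul_zero_iff hrn, hr.dvd_mul, hr.dvd_mul] at this
    have := ndvd_of_Ico hc
    tauto

set_option maxHeartbeats 1000000 in
lemma no_coset {p q r l : ℕ} (hp : p.Prime) (hq : q.Prime) (hr : r.Prime) (hl : l.Prime)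
    (hpn : p ∣ n) (hqn : q ∣ n) (hrn : r ∣ n) (hln : l ∣ n)
    (hpq : p ≠ q) (hpr : p ≠ r) (hqr : q ≠ r) (m : ℕ)
    (H : ∀ k : Fin l, ((m + n / l * k : ℕ) : ZMod n) ∈ S n p q r) : False := by
  have hP : (p : ZMod n) * ((n / p : ℕ) : ZMod n) = 0 := (mul_zero_iff hpn p).2 dvd_rfl
  have hQ : (q : ZMod n) * ((n / q : ℕ) : ZMod n) = 0 := (mul_zero_iff hqn q).2 dvd_rfl
  have hR : (r : ZMod n) * ((n / r : ℕ) : ZMod n) = 0 := (mul_zero_iff hrn r).2 dvd_rfl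
  have hL : (l : ZMod n) * ((n / l : ℕ) : ZMod n) = 0 := (mul_zero_iff hln l).2 dvd_rfl
  have T := fun k => S_sub hp hq hr hpn hqn hrn hpq hpr hqr (H k)
  have m0 : (m : ZMod n) ∈ S n p q r := by
    have := H ⟨0, hl.pos⟩
    simpa using this
  have T0 := S_sub hp hq hr hpn hqn hrn hpq hpr hqr m0
  have T1 := T ⟨1, hl.one_lt⟩
  have d1 : (l ∣ p) ↔ l = p := Nat.prime_dvd_prime_iff_eq hl hp
  have d2 : (l ∣ q) ↔ l = q := Nat.prime_dvd_prime_iff_eq hl hq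
  have d3 : (l ∣ r) ↔ l = r := Nat.prime_dvd_prime_iff_eq hl hr
  have zpq : ((p : ZMod n) * q * ((n / l : ℕ) : ZMod n) = 0) ↔ (l = p ∨ l = q) := by
    rw [← d1, ← d2, ← hl.dvd_mul, ← mul_zero_iff hln, Nat.cast_mul]
  have zr : ((r : ZMod n) * ((n / l : ℕ) : ZMod n) = 0) ↔ l = r := by
    rw [← d3, ← mul_zero_iff hln]
  have zpqr : ((p : ZMod n) * q * r * ((n / l : ℕ) : ZMod n) = 0) ↔ (l = p ∨ l = q) ∨ l = r := by
    rw [← d1, ← d2, ← d3, ← hl.dvd_mul, ← hl.dvd_mul, ← mul_zero_iff hln, Nat.cast_mul,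
      Nat.cast_mul]
  simp only [Nat.cast_add, Nat.cast_mul, Nat.cast_one, mul_one] at T1
  simp only [Nat.cast_add, Nat.cast_mul] at T
  -- elements of second type cannot be in a coset of order different from `r`
  have A : l ≠ r → (r * (m : ZMod n)) = 0 → (p * q * (m : ZMod n)) ≠ 0 → False := by
    intro hlr h1 h2
    have n1 : ¬ ((r : ZMod n) * ((n / l : ℕ) : ZMod n) = 0) := by rw [zr]; exact hlr
    rcases T1 with ⟨t1, -, -⟩ | ⟨t1, -⟩
    · by_cases hh : l = p ∨ l = q
      · exact h2 (by linear_combination t1 - zpq.2 hh)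
      · have : ¬ ((p : ZMod n) * q * r * ((n / l : ℕ) : ZMod n) = 0) := by
          rw [zpqr]; exact not_or.2 ⟨hh, hlr⟩
        exact this (by linear_combination (r : ZMod n) * t1 - (p * q : ZMod n) * h1)
    · exact n1 (by linear_combination t1 - h1)
  by_cases l1 : l = r
  · subst l1
    rcases m0 with ⟨a, ha, b, hb, hm⟩ | ⟨c, hc, hm⟩
    · rcases T0 with ⟨t1, t2, t3⟩ | ⟨t1, t2⟩
      · rcases T1 with ⟨s1, -, -⟩ | ⟨s1, -⟩
        · have : ¬ ((p : ZMod n) * q * ((n / l : ℕ) : ZMod n) = 0) := by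
            rw [zpq]; rintro (h | h)
            · exact hpr h.symm
            · exact hqr h.symm
          exact this (by linear_combination s1 - t1)
        · exact t2 (by linear_combination (q : ZMod n) * s1 - (q : ZMod n) * hL)
      · apply t2
        rw [hm]; simp only [Nat.cast_mul]
        linear_combination (q * a : ZMod n) * hP + (p * b : ZMod n) * hQ
    · rw [Finset.mem_Ico] at hc
      have h := T ⟨l - c, by omega⟩
      have hz : (m : ZMod n) + ((n / l : ℕ) : ZMod n) * ((l - c : ℕ) : ZMod n) = 0 := by
        rw [hm, Nat.cast_sub hc.2.le, Nat.cast_mul]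
        linear_combination hL
      simp only at h
      rw [hz] at h
      simp at h
  · rcases m0 with ⟨a, ha, b, hb, hm⟩ | ⟨c, hc, hm⟩
    · have hpqm : (p * q * (m : ZMod n)) = 0 := by
        rw [hm]; simp only [Nat.cast_mul]
        linear_combination (q * a : ZMod n) * hP + (p * b : ZMod n) * hQ
      by_cases l2 : l = p
      · subst l2
        rw [Finset.mem_Ico] at ha
        have h := T ⟨l - a, by omega⟩
        have hz : (m : ZMod n) + ((n / l : ℕ) : ZMod n) * ((l - a : ℕ) : ZMod n)
            = ((n / q : ℕ) : ZMod n) * b := by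
          rw [hm, Nat.cast_sub ha.2.le, Nat.cast_mul, Nat.cast_mul]
          linear_combination hL
        simp only at h
        rw [hz] at h
        rcases h with ⟨-, t, -⟩ | ⟨-, t⟩
        · exact t (by linear_combination (r * b : ZMod n) * hQ)
        · exact t (by linear_combination (l * b : ZMod n) * hQ)
      by_cases l3 : l = q
      · subst l3
        rw [Finset.mem_Ico] at hb
        have h := T ⟨l - b, by omega⟩
        have hz : (m : ZMod n) + ((n / l : ℕ) : ZMod n) * ((l - b : ℕ) : ZMod n)
            = ((n / p : ℕ) : ZMod n) * a := by
          rw [hm, Nat.cast_sub hb.2.le, Nat.cast_mul, Nat.cast_mul]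
          linear_combination hL
        simp only at h
        rw [hz] at h
        rcases h with ⟨-, -, t⟩ | ⟨-, t⟩
        · exact t (by linear_combination (r * a : ZMod n) * hP)
        · exact t (by linear_combination (l * a : ZMod n) * hP)
      have n1 : ¬ ((p : ZMod n) * q * ((n / l : ℕ) : ZMod n) = 0) := by rw [zpq]; exact not_or.2 ⟨l2, l3⟩
      have n2 : ¬ ((p : ZMod n) * q * r * ((n / l : ℕ) : ZMod n) = 0) := by
        rw [zpqr]; exact not_or.2 ⟨not_or.2 ⟨l2, l3⟩, l1⟩
      rcases T1 with ⟨s1, -, -⟩ | ⟨s1, -⟩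
      · exact n1 (by linear_combination s1 - hpqm)
      · exact n2 (by linear_combination (p * q : ZMod n) * s1 - (r : ZMod n) * hpqm)
    · rcases T0 with ⟨t1, t2, t3⟩ | ⟨t1, t2⟩
      · apply t2
        rw [hm, Nat.cast_mul]
        linear_combination (q * c : ZMod n) * hR
      · exact A l1 t1 t2

end S19

/-- If `n` has at least three distinct prime factors, the subring `R_n` generated by the
circulant determinants `Θ_p(y^(p)_i)` (`p` prime factor of `n`, `0 ≤ i < n/p`) is strictly
contained in the invariant ring `ℂ[x]^D = {f : Df = 0}`. -/
theorem stmt19 (n : ℕ) [NeZero n] (hfac : 3 ≤ n.primeFactors.card)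
    (ζ : ℂ) (hζ : IsPrimitiveRoot ζ n) :
    (↑(Algebra.adjoin ℂ
        {g : MvPolynomial (ZMod n) ℂ | ∃ p ∈ n.primeFactors, ∃ i < n / p,
          g = thetaCirc p (fun j => ypVar n p ζ i j)}) : Set (MvPolynomial (ZMod n) ℂ))
      ⊂ {f : MvPolynomial (ZMod n) ℂ | ∑ k : ZMod n, X (k - 1) * pderiv k f = 0} := by
  classical
  obtain ⟨p, hp', q, hq', r, hr', hpq, hpr, hqr⟩ := Finset.two_lt_card.1 hfac
  have hp := Nat.prime_of_mem_primeFactors hp'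
  have hq := Nat.prime_of_mem_primeFactors hq'
  have hr := Nat.prime_of_mem_primeFactors hr'
  have hpn := Nat.dvd_of_mem_primeFactors hp'
  have hqn := Nat.dvd_of_mem_primeFactors hq'
  have hrn := Nat.dvd_of_mem_primeFactors hr'
  set ψ := S19.psi ζ hζ.pow_eq_one with hψ
  have hprim : ψ.IsPrimitive := AddChar.zmodChar_primitive_of_primitive_root n hζ
  rw [Set.ssubset_iff_subset_ne]
  refine ⟨?_, ?_⟩
  · intro f hf
    rw [Set.mem_setOf_eq, ← S19.D_apply]
    induction hf using Algebra.adjoin_induction with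
    | mem g hg =>
      obtain ⟨l, hl', i, -, rfl⟩ := hg
      have hl := Nat.prime_of_mem_primeFactors hl'
      have hln := Nat.dvd_of_mem_primeFactors hl'
      rw [S19.theta_eq hl.ne_zero hln ζ hζ, S19.D_prod]
      have := S19.sum_root hl hln ζ hζ
      rw [Finset.sum_range] at this
      simp only [Nat.cast_add, AddChar.map_add_eq_mul]
      rw [← Finset.mul_sum, this]
      simp
    | algebraMap c => simp
    | add x y _ _ hx hy => rw [map_add, hx, hy, add_zero]
    | mul x y _ _ hx hy => rw [Derivation.leibniz, hx, hy]; simp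
  · intro heq
    set g1 : ℕ × ℕ → ZMod n := fun x =>
      ((n / p * x.1 : ℕ) : ZMod n) + ((n / q * x.2 : ℕ) : ZMod n) with hg1
    set g2 : ℕ → ZMod n := fun x => ((n / r * x : ℕ) : ZMod n) with hg2
    set f : MvPolynomial (ZMod n) ℂ :=
      (∏ x ∈ Finset.Ico 1 p ×ˢ Finset.Ico 1 q, S19.u ψ (g1 x)) *
        ∏ x ∈ Finset.Ico 1 r, S19.u ψ (g2 x) with hf
    have hDf : S19.D n f = 0 := by
      rw [hf, Derivation.leibniz, S19.D_prod, S19.D_prod]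
      have h1 : ∑ x ∈ Finset.Ico 1 p ×ˢ Finset.Ico 1 q, ψ (g1 x) = 1 := by
        simp only [hg1, AddChar.map_add_eq_mul]
        rw [Finset.sum_product]
        simp only
        rw [← Finset.sum_mul_sum, S19.sum_root' hp hpn ζ hζ, S19.sum_root' hq hqn ζ hζ]
        norm_num
      have h2 : ∑ x ∈ Finset.Ico 1 r, ψ (g2 x) = -1 := S19.sum_root' hr hrn ζ hζ
      rw [h1, h2]
      simp only [smul_eq_mul, C_neg, C_1]
      ring
    have hmem : f ∈ Algebra.adjoin ℂ
        {g : MvPolynomial (ZMod n) ℂ | ∃ p ∈ n.primeFactors, ∃ i < n / p,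
          g = thetaCirc p (fun j => ypVar n p ζ i j)} := by
      rw [← SetLike.mem_coe, heq, Set.mem_setOf_eq, ← S19.D_apply, hDf]
    have hagree : ∀ g ∈ Algebra.adjoin ℂ
        {g : MvPolynomial (ZMod n) ℂ | ∃ p ∈ n.primeFactors, ∃ i < n / p,
          g = thetaCirc p (fun j => ypVar n p ζ i j)},
        aeval (S19.pt ψ (S19.S n p q r)) g = aeval (0 : ZMod n → ℂ) g := by
      intro g hg
      induction hg using Algebra.adjoin_induction with
      | mem g hg =>
        obtain ⟨l, hl', i, -, rfl⟩ := hg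
        have hl := Nat.prime_of_mem_primeFactors hl'
        have hln := Nat.dvd_of_mem_primeFactors hl'
        rw [S19.theta_eq hl.ne_zero hln ζ hζ, map_prod, map_prod]
        have : ∃ k : Fin l, ((i + n / l * k : ℕ) : ZMod n) ∉ S19.S n p q r := by
          by_contra hcon
          push Not at hcon
          exact S19.no_coset hp hq hr hl hpn hqn hrn hln hpq hpr hqr i hcon
        obtain ⟨k, hk⟩ := this
        rw [Finset.prod_eq_zero (Finset.mem_univ k), Finset.prod_eq_zero (Finset.mem_univ k)]
        · exact S19.aeval_zero_u _ _
        · rw [S19.aeval_u _ hprim, if_neg hk]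
      | algebraMap c => simp
      | add x y _ _ hx hy => rw [map_add, map_add, hx, hy]
      | mul x y _ _ hx hy => rw [map_mul, map_mul, hx, hy]
    have h := hagree f hmem
    have hL : aeval (S19.pt ψ (S19.S n p q r)) f = 1 := by
      rw [hf, map_mul, map_prod, map_prod, Finset.prod_eq_one, Finset.prod_eq_one, mul_one]
      · intro x hx
        rw [S19.aeval_u _ hprim, if_pos]
        exact Or.inr ⟨x, hx, rfl⟩
      · intro x hx
        rw [Finset.mem_product] at hx
        rw [S19.aeval_u _ hprim, if_pos]
        exact Or.inl ⟨x.1, hx.1, x.2, hx.2, rfl⟩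
    have hR : aeval (0 : ZMod n → ℂ) f = 0 := by
      have h1 : 1 ∈ Finset.Ico 1 r := by simp [hr.one_lt]
      rw [hf, map_mul, map_prod, map_prod, Finset.prod_eq_zero h1 (S19.aeval_zero_u _ _), mul_zero]
    rw [hL, hR] at h
    exact one_ne_zero h
end
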